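/- The support of every potential is orthogonal to the support of every stationary normal state: if y is a potential for T and φ is a normal state with φ ∘ T = φ, then φ(y) = 0, and hence supp y ≤ (supp φ)^⊥. Consequently the maximal transient projection p_Tr and the maximal positive recurrent projection p_R satisfy p_Tr ≤ p_R^⊥. -/

import Mathlib

open Filter Topology ContinuousLinearMap

namespace QMP

variable {H : Type*} [NormedAddCommGroup H] [InnerProductSpace ℂ H] [CompleteSpace H]

/-- `T` is a (quantum) Markov operator on the von Neumann algebra `A`:
a normal, unital, completely positive linear map leaving `A` invariant. -/
structure IsMarkov (A : VonNeumannAlgebra H) (T : (H →L[ℂ] H) → (H →L[ℂ] H)) : Prop where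
  linear : IsLinearMap ℂ T
  mapsSelf : ∀ x ∈ A, T x ∈ A
  unital : T 1 = 1
  cp : ∀ (n : ℕ) (a b : Fin n → (H →L[ℂ] H)),
    0 ≤ ∑ i : Fin n, ∑ j : Fin n, star (b i) * T (star (a i) * a j) * b j
  normal : ∀ {ι : Type} [Preorder ι] [IsDirected ι (· ≤ ·)] (f : ι → (H →L[ℂ] H))
    (y : H →L[ℂ] H), Monotone f → IsLUB (Set.range f) y →
      IsLUB (Set.range fun i => T (f i)) (T y)

/-- `y = ∑ₙ Tⁿ x` with convergence in the strong operator topology. -/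
def SOTSum (T : (H →L[ℂ] H) → (H →L[ℂ] H)) (x y : H →L[ℂ] H) : Prop :=
  ∀ η : H, Tendsto (fun N => ∑ n ∈ Finset.range N, (T^[n] x) η) atTop (𝓝 (y η))

/-- `x ∈ A₊` is `T`-summable: `∑ₙ Tⁿ x` converges strongly to an element of `A₊`. -/
def TSummable (A : VonNeumannAlgebra H) (T : (H →L[ℂ] H) → (H →L[ℂ] H))
    (x : H →L[ℂ] H) : Prop :=
  x ∈ A ∧ 0 ≤ x ∧ ∃ y, y ∈ A ∧ 0 ≤ y ∧ SOTSum T x y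

/-- `y` is a potential for `T`: `y = ∑ₙ Tⁿ x` for some `x ∈ A₊`. -/
def IsPotential (A : VonNeumannAlgebra H) (T : (H →L[ℂ] H) → (H →L[ℂ] H))
    (y : H →L[ℂ] H) : Prop :=
  y ∈ A ∧ 0 ≤ y ∧ ∃ x, x ∈ A ∧ 0 ≤ x ∧ SOTSum T x y

/-- `p` is an orthogonal projection belonging to `A`. -/
def IsProj (A : VonNeumannAlgebra H) (p : H →L[ℂ] H) : Prop :=
  p ∈ A ∧ IsSelfAdjoint p ∧ IsIdempotentElem p

/-- `p` is the support projection of the self-adjoint element `a`. -/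
def IsSupport (A : VonNeumannAlgebra H) (a p : H →L[ℂ] H) : Prop :=
  IsProj A p ∧ a = p * a * p ∧ ∀ q, IsProj A q → a = q * a * q → p ≤ q

/-- `s` is the supremum of the family of projections `q` in the projection lattice of `A`. -/
def IsProjSup (A : VonNeumannAlgebra H) {ι : Type*} (q : ι → (H →L[ℂ] H))
    (s : H →L[ℂ] H) : Prop :=
  IsProj A s ∧ (∀ i, q i ≤ s) ∧ ∀ r, IsProj A r → (∀ i, q i ≤ r) → s ≤ r

end QMP

namespace QMP

variable {H : Type*} [NormedAddCommGroup H] [InnerProductSpace ℂ H] [CompleteSpace H]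

/-- `p` is a transient projection for `T`: it is dominated by the supremum of a family of
`T`-summable projections. -/
def Transient (A : VonNeumannAlgebra H) (T : (H →L[ℂ] H) → (H →L[ℂ] H))
    (p : H →L[ℂ] H) : Prop :=
  ∃ (ι : Type) (q : ι → (H →L[ℂ] H)) (s : H →L[ℂ] H),
    (∀ i, IsProj A (q i) ∧ TSummable A T (q i)) ∧ IsProjSup A q s ∧ p ≤ s

/-- `e` is the maximal transient projection `p_Tr`: the supremum of all transient
projections of `A`. -/
def IsMaxTransient (A : VonNeumannAlgebra H) (T : (H →L[ℂ] H) → (H →L[ℂ] H))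
    (e : H →L[ℂ] H) : Prop :=
  IsProj A e ∧ (∀ p, IsProj A p → Transient A T p → p ≤ e) ∧
    ∀ r, IsProj A r → (∀ p, IsProj A p → Transient A T p → p ≤ r) → e ≤ r

end QMP

namespace QMP

variable {H : Type*} [NormedAddCommGroup H] [InnerProductSpace ℂ H] [CompleteSpace H]

/-- A normal state on the von Neumann algebra `A`: a positive unital linear functional which
is continuous along bounded monotone sequences converging in the strong operator topology. -/
structure IsNormalState (A : VonNeumannAlgebra H) (φ : (H →L[ℂ] H) → ℂ) : Prop where
  linear : IsLinearMap ℂ φ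
  unital : φ 1 = 1
  pos : ∀ x : H →L[ℂ] H, 0 ≤ x → ∃ r : ℝ, 0 ≤ r ∧ φ x = r
  normal : ∀ (f : ℕ → (H →L[ℂ] H)) (y : H →L[ℂ] H), (∀ n, f n ∈ A) → Monotone f →
    (∀ η : H, Filter.Tendsto (fun n => (f n) η) Filter.atTop (nhds (y η))) →
    Filter.Tendsto (fun n => φ (f n)) Filter.atTop (nhds (φ y))

/-- `φ` is stationary for `T`: `φ ∘ T = φ`. -/
def Stationary (T : (H →L[ℂ] H) → (H →L[ℂ] H)) (φ : (H →L[ℂ] H) → ℂ) : Prop :=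
  ∀ x : H →L[ℂ] H, φ (T x) = φ x

/-- `s` is the support projection of the state `φ`: the smallest projection `p ∈ A` with
`φ x = φ (p x p)` for all `x ∈ A`. -/
def IsStateSupport (A : VonNeumannAlgebra H) (φ : (H →L[ℂ] H) → ℂ)
    (s : H →L[ℂ] H) : Prop :=
  IsProj A s ∧ (∀ x ∈ A, φ x = φ (s * x * s)) ∧
    ∀ q, IsProj A q → (∀ x ∈ A, φ x = φ (q * x * q)) → s ≤ q

/-- `r` is the maximal positive recurrent projection `p_R`: the supremum of the supports of
all stationary normal states of `T`. -/
def IsMaxPosRecurrent (A : VonNeumannAlgebra H) (T : (H →L[ℂ] H) → (H →L[ℂ] H))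
    (r : H →L[ℂ] H) : Prop :=
  IsProj A r ∧
    (∀ φ s, IsNormalState A φ → Stationary T φ → IsStateSupport A φ s → s ≤ r) ∧
    ∀ q, IsProj A q →
      (∀ φ s, IsNormalState A φ → Stationary T φ → IsStateSupport A φ s → s ≤ q) → r ≤ q

end QMP

open QMP

namespace QMP

variable {H : Type*} [NormedAddCommGroup H] [InnerProductSpace ℂ H] [CompleteSpace H]

/-- An affine function of a real variable that stays nonnegative is constant. -/
theorem eq_zero_of_forall_add_mul_nonneg {a b : ℝ} (h : ∀ k : ℝ, 0 ≤ a + k * b) : b = 0 := by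
  by_contra hb
  have := h (-(a + 1) / b)
  rw [div_mul_cancel₀ _ hb] at this
  linarith

/-- The null-vector case of the Cauchy–Schwarz inequality for a positive functional. -/
theorem map_star_mul_eq_zero (f : (H →L[ℂ] H) →ₗ[ℂ] ℂ)
    (hf : ∀ x, 0 ≤ x → ∃ r : ℝ, 0 ≤ r ∧ f x = r) {v : H →L[ℂ] H} (hv : f (star v * v) = 0)
    (u : H →L[ℂ] H) : f (star u * v) = 0 ∧ f (star v * u) = 0 := by
  set c := f (star u * v)
  set d := f (star v * u)
  set R := f (star u * u)
  have key (t : ℂ) : 0 ≤ (R + t * c + star t * d).re ∧ (R + t * c + star t * d).im = 0 := by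
    obtain ⟨r, hr, h⟩ := hf (star (u + t • v) * (u + t • v)) (star_mul_self_nonneg _)
    have e : f (star (u + t • v) * (u + t • v)) = R + t * c + star t * d := by
      simp only [star_add, star_smul, add_mul, mul_add, smul_mul_assoc, mul_smul_comm, map_add,
        map_smul, hv, smul_eq_mul]
      ring
    rw [← e, h]
    simpa using hr
  have h1 : ∀ k : ℝ, 0 ≤ R.re + k * (c.re + d.re) := fun k => by
    have := (key k).1
    simp at this
    linarith
  have h2 : ∀ k : ℝ, 0 ≤ R.re + k * (d.im - c.im) := fun k => by
    have := (key (k * Complex.I)).1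
    simp at this
    linarith
  have h3 := (key 0).2
  have h4 := (key 1).2
  have h5 := (key Complex.I).2
  simp at h3 h4 h5
  have h1 := eq_zero_of_forall_add_mul_nonneg h1
  have h2 := eq_zero_of_forall_add_mul_nonneg h2
  exact ⟨Complex.ext (by simp; linarith) (by simp; linarith),
    Complex.ext (by simp; linarith) (by simp; linarith)⟩

theorem map_mul_eq_zero_of_nonneg (f : (H →L[ℂ] H) →ₗ[ℂ] ℂ)
    (hf : ∀ x, 0 ≤ x → ∃ r : ℝ, 0 ≤ r ∧ f x = r) {a : H →L[ℂ] H} (ha : 0 ≤ a) (h : f a = 0)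
    (z : H →L[ℂ] H) : f (z * a) = 0 ∧ f (a * z) = 0 := by
  obtain ⟨v, rfl⟩ := CStarAlgebra.nonneg_iff_eq_star_mul_self.1 ha
  refine ⟨?_, ?_⟩
  · simpa [mul_assoc] using (map_star_mul_eq_zero f hf h (v * star z)).1
  · simpa [mul_assoc] using (map_star_mul_eq_zero f hf h (v * z)).2

theorem IsProj.nonneg {A : VonNeumannAlgebra H} {p : H →L[ℂ] H} (hp : IsProj A p) : 0 ≤ p := by
  simpa [hp.2.1.star_eq, hp.2.2.eq] using star_mul_self_nonneg p

theorem IsProj.one_sub {A : VonNeumannAlgebra H} {p : H →L[ℂ] H} (hp : IsProj A p) :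
    IsProj A (1 - p) :=
  ⟨sub_mem (one_mem _) hp.1, (IsSelfAdjoint.one _).sub hp.2.1, hp.2.2.one_sub⟩

/-- A projection on which a state vanishes is orthogonal to the support of the state. -/
theorem IsStateSupport.le_one_sub {A : VonNeumannAlgebra H} {φ : (H →L[ℂ] H) → ℂ}
    {s q : H →L[ℂ] H} (hs : IsStateSupport A φ s) (hφ : IsNormalState A φ) (hq : IsProj A q)
    (h : φ q = 0) : q ≤ 1 - s := by
  refine le_sub_comm.1 (hs.2.2 _ hq.one_sub fun x _ => ?_)
  have key (z) := map_mul_eq_zero_of_nonneg (hφ.linear.mk' φ) hφ.pos hq.nonneg h z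
  have e : (1 - q) * x * (1 - q) = x - q * x - (x * q - q * x * q) := by noncomm_ring
  change hφ.linear.mk' φ x = hφ.linear.mk' φ _
  rw [e, map_sub, map_sub, map_sub, (key x).2, (key x).1, (key (q * x)).1]
  simp

theorem IsNormalState.monotone {A : VonNeumannAlgebra H} {φ : (H →L[ℂ] H) → ℂ}
    (hφ : IsNormalState A φ) {x y : H →L[ℂ] H} (h : x ≤ y) : (φ x).re ≤ (φ y).re := by
  obtain ⟨r, hr, e⟩ := hφ.pos (y - x) (sub_nonneg.2 h)
  rw [hφ.linear.map_sub] at e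
  have := congrArg Complex.re e
  simp at this
  linarith

theorem IsNormalState.eq_zero_of_le {A : VonNeumannAlgebra H} {φ : (H →L[ℂ] H) → ℂ}
    (hφ : IsNormalState A φ) {x y : H →L[ℂ] H} (hx : 0 ≤ x) (h : x ≤ y) (hy : φ y = 0) :
    φ x = 0 := by
  obtain ⟨r, hr, e⟩ := hφ.pos x hx
  have := hφ.monotone h
  rw [hy, e] at this
  rw [e, le_antisymm (by simpa using this) hr, Complex.ofReal_zero]

theorem IsMarkov.map_nonneg {A : VonNeumannAlgebra H} {T : (H →L[ℂ] H) → (H →L[ℂ] H)}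
    (hT : IsMarkov A T) {x : H →L[ℂ] H} (hx : 0 ≤ x) : 0 ≤ T x := by
  obtain ⟨v, rfl⟩ := CStarAlgebra.nonneg_iff_eq_star_mul_self.1 hx
  simpa using hT.cp 1 (fun _ => v) (fun _ => 1)

/-- A stationary normal state vanishes on an element and on its potential. -/
theorem Stationary.eq_zero_of_sotSum {A : VonNeumannAlgebra H}
    {T : (H →L[ℂ] H) → (H →L[ℂ] H)} (hT : IsMarkov A T) {φ : (H →L[ℂ] H) → ℂ}
    (hφ : IsNormalState A φ) (hst : Stationary T φ) {x y : H →L[ℂ] H} (hxA : x ∈ A)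
    (hx : 0 ≤ x) (hy : SOTSum T x y) : φ x = 0 ∧ φ y = 0 := by
  have hA (n : ℕ) : T^[n] x ∈ A := by
    induction n with
    | zero => exact hxA
    | succ n ih => rw [Function.iterate_succ_apply']; exact hT.mapsSelf _ ih
  have h0 (n : ℕ) : 0 ≤ T^[n] x := by
    induction n with
    | zero => exact hx
    | succ n ih => rw [Function.iterate_succ_apply']; exact hT.map_nonneg ih
  have hφn (n : ℕ) : φ (T^[n] x) = φ x := by
    induction n with
    | zero => rfl
    | succ n ih => rw [Function.iterate_succ_apply', hst, ih]
  have hsum (N : ℕ) : φ (∑ n ∈ Finset.range N, T^[n] x) = N * φ x := by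
    change hφ.linear.mk' φ _ = _
    rw [map_sum]
    simp [hφn]
  have hlim := hφ.normal (fun N => ∑ n ∈ Finset.range N, T^[n] x) y
    (fun N => sum_mem fun n _ => hA n)
    (monotone_nat_of_le_succ fun N => by
      rw [Finset.sum_range_succ]
      exact le_add_of_nonneg_right (h0 N))
    (fun η => by simpa using hy η)
  simp only [hsum] at hlim
  have hstep : Tendsto (fun N : ℕ => ((N + 1 : ℕ) : ℂ) * φ x - N * φ x) atTop (𝓝 (φ y - φ y)) :=
    (hlim.comp (tendsto_add_atTop_nat 1)).sub hlim
  have hx0 : φ x = 0 := by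
    have : (fun N : ℕ => ((N + 1 : ℕ) : ℂ) * φ x - N * φ x) = fun _ => φ x := by
      funext N
      push_cast
      ring
    rw [this, sub_self] at hstep
    exact tendsto_nhds_unique tendsto_const_nhds hstep
  refine ⟨hx0, ?_⟩
  simp only [hx0, mul_zero] at hlim
  exact tendsto_nhds_unique hlim tendsto_const_nhds

/-- The powers of a positive contraction converge pointwise. -/
theorem cauchySeq_pow_apply {b : H →L[ℂ] H} (h0 : 0 ≤ b) (h1 : b ≤ 1) (η : H) :
    CauchySeq fun n : ℕ => (b ^ n) η := by
  set a : ℕ → ℝ := fun n => (inner ℂ ((b ^ n) η) η).re with ha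
  have hanti : Antitone a := fun m n hmn => by
    have h := sub_nonneg.2 (CStarAlgebra.pow_antitone h0 h1 hmn)
    rw [ContinuousLinearMap.nonneg_iff_isPositive] at h
    have := h.re_inner_nonneg_left η
    simp [inner_sub_left] at this
    simpa [ha] using this
  have hpos (n) : 0 ≤ a n := by
    have h : 0 ≤ b ^ n := CStarAlgebra.pow_nonneg h0 n
    rw [ContinuousLinearMap.nonneg_iff_isPositive] at h
    exact h.re_inner_nonneg_left η
  have hbdd : BddBelow (Set.range a) := ⟨0, by rintro _ ⟨n, rfl⟩; exact hpos n⟩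
  have hlim := tendsto_atTop_ciInf hanti hbdd
  set L := ⨅ n, a n
  have hL (n) : L ≤ a n := ciInf_le hbdd n
  have hsa (n : ℕ) : IsSelfAdjoint (b ^ n) := (IsSelfAdjoint.of_nonneg h0).pow n
  have hin (n m : ℕ) : (inner ℂ ((b ^ n) η) ((b ^ m) η)).re = a (m + n) := by
    simp only [ha, pow_add]
    rw [mul_apply_eq_comp, ← ContinuousLinearMap.adjoint_inner_left,
      ← ContinuousLinearMap.star_eq_adjoint, (hsa m).star_eq]
  have hsq (n m : ℕ) : dist ((b ^ n) η) ((b ^ m) η) ^ 2 = a (n + n) - 2 * a (n + m) + a (m + m) := by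
    have h := @norm_sub_sq ℂ H _ _ _ ((b ^ n) η) ((b ^ m) η)
    have e1 := @inner_self_eq_norm_sq ℂ H _ _ _ ((b ^ n) η)
    have e2 := @inner_self_eq_norm_sq ℂ H _ _ _ ((b ^ m) η)
    simp only [RCLike.re_to_complex, hin] at h e1 e2
    rw [dist_eq_norm, h, e1, e2, add_comm m n]
  refine cauchySeq_of_le_tendsto_0 (fun N => √(2 * (a (N + N) - L))) (fun n m N hn hm => ?_) ?_
  · refine Real.le_sqrt_of_sq_le ?_
    rw [hsq]
    have e1 := hanti (add_le_add hn hn)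
    have e2 := hanti (add_le_add hm hm)
    have e3 := hL (n + m)
    linarith
  · have h2 : Tendsto (fun N : ℕ => N + N) atTop atTop :=
      tendsto_atTop_mono (fun N => Nat.le_add_left N N) tendsto_id
    have := (((hlim.comp h2).sub_const L).const_mul 2).sqrt
    simpa using this

/-- The powers of a positive contraction converge strongly to the projection onto its
fixed vectors. -/
theorem tendsto_pow_apply {b : H →L[ℂ] H} (h0 : 0 ≤ b) (h1 : b ≤ 1) (K : Submodule ℂ H)
    [K.HasOrthogonalProjection] (hK : ∀ v, v ∈ K ↔ b v = v) (η : H) :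
    Tendsto (fun n : ℕ => (b ^ n) η) atTop (𝓝 (K.starProjection η)) := by
  have hsa (n : ℕ) : IsSelfAdjoint (b ^ n) := (IsSelfAdjoint.of_nonneg h0).pow n
  have hfix (n : ℕ) (v : H) (hv : v ∈ K) : (b ^ n) v = v := by
    induction n with
    | zero => simp
    | succ n ih => rw [pow_succ, mul_apply_eq_comp, (hK v).1 hv, ih]
  have hperp (v : H) (hv : v ∈ Kᗮ) : Tendsto (fun n : ℕ => (b ^ n) v) atTop (𝓝 0) := by
    obtain ⟨l, hl⟩ := cauchySeq_tendsto_of_complete (cauchySeq_pow_apply h0 h1 v)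
    have hbl : b l = l := by
      refine tendsto_nhds_unique ((b.continuous.tendsto l).comp hl) ?_
      have (n : ℕ) : b ((b ^ n) v) = (b ^ (n + 1)) v := by rw [pow_succ', mul_apply_eq_comp]
      simpa only [Function.comp_def, this] using hl.comp (tendsto_add_atTop_nat 1)
    have hlperp : l ∈ Kᗮ := by
      refine K.isClosed_orthogonal.mem_of_tendsto hl (Eventually.of_forall fun n => ?_)
      refine (Submodule.mem_orthogonal _ _).2 fun w hw => ?_
      rw [← ContinuousLinearMap.adjoint_inner_left, ← ContinuousLinearMap.star_eq_adjoint,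
        (hsa n).star_eq, hfix n w hw]
      exact (Submodule.mem_orthogonal _ _).1 hv w hw
    have : l = 0 := by
      have := (Submodule.mem_orthogonal _ _).1 hlperp l ((hK l).2 hbl)
      simpa using this
    rwa [this] at hl
  have hmem : K.starProjection η ∈ K := K.starProjection_apply_mem η
  have h := (hperp _ (K.sub_starProjection_mem_orthogonal η)).const_add (K.starProjection η)
  simpa [map_sub, hfix _ _ hmem] using h

/-- A von Neumann algebra is sequentially closed in the strong operator topology. -/
theorem mem_of_tendsto_apply {A : VonNeumannAlgebra H} {f : ℕ → (H →L[ℂ] H)} {p : H →L[ℂ] H}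
    (hf : ∀ n, f n ∈ A) (hlim : ∀ η, Tendsto (fun n => f n η) atTop (𝓝 (p η))) : p ∈ A := by
  rw [← VonNeumannAlgebra.commutant_commutant A, VonNeumannAlgebra.mem_commutant_iff]
  intro g hg
  rw [VonNeumannAlgebra.mem_commutant_iff] at hg
  ext η
  refine tendsto_nhds_unique ((g.continuous.tendsto _).comp (hlim η)) ?_
  have (n : ℕ) : g (f n η) = f n (g η) := (DFunLike.congr_fun (hg (f n) (hf n)) η).symm
  simpa [Function.comp_def, this] using hlim (g η)

/-- A normal state vanishing on a positive element vanishes on its support. -/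
theorem IsSupport.map_eq_zero {A : VonNeumannAlgebra H} {φ : (H →L[ℂ] H) → ℂ}
    (hφ : IsNormalState A φ) {y q : H →L[ℂ] H} (hq : IsSupport A y q) (hyA : y ∈ A)
    (hy : 0 ≤ y) (h : φ y = 0) : φ q = 0 := by
  obtain ⟨c, hc, hcy⟩ : ∃ c : ℝ, 0 < c ∧ c • y ≤ 1 := by
    refine ⟨(‖y‖ + 1)⁻¹, by positivity, ?_⟩
    rw [← CStarAlgebra.norm_le_one_iff_of_nonneg _ (smul_nonneg (by positivity) hy), norm_smul,
      norm_inv, Real.norm_of_nonneg (by positivity), inv_mul_le_one₀ (by positivity)]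
    linarith
  set a : H →L[ℂ] H := (c : ℂ) • y with ha
  have hac : a = c • y := by ext; simp [ha]
  have ha0 : 0 ≤ a := hac ▸ smul_nonneg hc.le hy
  have haA : a ∈ A := A.toStarSubalgebra.smul_mem hyA _
  have hφa : φ a = 0 := by rw [ha, hφ.linear.map_smul, h, smul_zero]
  set b : H →L[ℂ] H := 1 - a with hb
  have hb0 : 0 ≤ b := sub_nonneg.2 (hac ▸ hcy)
  have hb1 : b ≤ 1 := sub_le_self _ ha0
  have hbA : b ∈ A := sub_mem (one_mem _) haA
  let K : Submodule ℂ H := LinearMap.ker (y : H →ₗ[ℂ] H)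
  have : CompleteSpace K := y.isClosed_ker.completeSpace_coe
  have hK (v : H) : v ∈ K ↔ b v = v := by
    simp [K, hb, ha, hc.ne']
  set P := K.starProjection with hP
  have hlim := tendsto_pow_apply hb0 hb1 K hK
  have hPA : P ∈ A := mem_of_tendsto_apply (fun n => pow_mem hbA n) hlim
  have hPproj : IsProj A P := ⟨hPA, isSelfAdjoint_starProjection K, K.isIdempotentElem_starProjection⟩
  have hyP : y * P = 0 := by
    ext η
    exact K.starProjection_apply_mem η
  have hPy : P * y = 0 := by
    have := congrArg star hyP
    simpa [hPproj.2.1.star_eq, (IsSelfAdjoint.of_nonneg hy).star_eq] using this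
  have hqP : q ≤ 1 - P := by
    refine hq.2.2 _ hPproj.one_sub ?_
    simp [sub_mul, mul_sub, hyP, hPy]
  have hφpow (n : ℕ) : φ (1 - b ^ n) = 0 := by
    have e : 1 - b ^ n = (∑ i ∈ Finset.range n, b ^ i) * a := by
      rw [← mul_neg_geom_sum b n, hb, sub_sub_cancel]
      exact (Commute.sum_right _ _ _ fun i _ =>
        ((Commute.one_right a).sub_right (Commute.refl a)).pow_right i).eq
    rw [e]
    exact (map_mul_eq_zero_of_nonneg (hφ.linear.mk' φ) hφ.pos ha0 hφa _).1
  have hφlim := hφ.normal (fun n => 1 - b ^ n) (1 - P)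
    (fun n => sub_mem (one_mem _) (pow_mem hbA n))
    (fun m n hmn => sub_le_sub_left (CStarAlgebra.pow_antitone hb0 hb1 hmn) 1)
    (fun η => by simpa using (hlim η).const_sub η)
  simp only [hφpow] at hφlim
  exact hφ.eq_zero_of_le hq.1.nonneg hqP (tendsto_nhds_unique hφlim tendsto_const_nhds)

end QMP

/-- Every stationary normal state vanishes on every potential; hence the support of a
potential is orthogonal to the support of any stationary normal state, and the maximal
transient projection is dominated by the complement of the maximal positive recurrent
projection. -/
theorem potential_orthogonal_to_stationary_states
    {H : Type*} [NormedAddCommGroup H] [InnerProductSpace ℂ H] [CompleteSpace H]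
    (A : VonNeumannAlgebra H) (T : (H →L[ℂ] H) → (H →L[ℂ] H)) (hT : IsMarkov A T) :
    (∀ y φ, IsPotential A T y → IsNormalState A φ → Stationary T φ → φ y = 0) ∧
    (∀ y φ q s, IsPotential A T y → IsNormalState A φ → Stationary T φ →
      IsSupport A y q → IsStateSupport A φ s → q ≤ 1 - s) ∧
    (∀ e r, IsMaxTransient A T e → IsMaxPosRecurrent A T r → e ≤ 1 - r) := by
  refine ⟨?_, ?_, ?_⟩
  · rintro y φ ⟨-, -, x, hxA, hx, hxy⟩ hφ hst
    exact (hst.eq_zero_of_sotSum hT hφ hxA hx hxy).2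
  · rintro y φ q s ⟨hyA, hy, x, hxA, hx, hxy⟩ hφ hst hq hs
    exact hs.le_one_sub hφ hq.1
      (hq.map_eq_zero hφ hyA hy (hst.eq_zero_of_sotSum hT hφ hxA hx hxy).2)
  · rintro e r he hr
    refine le_sub_comm.1 (hr.2.2 _ he.1.one_sub fun φ s hφ hst hs => le_sub_comm.1 ?_)
    refine he.2.2 _ hs.1.one_sub ?_
    rintro p - ⟨ι, q, t, hq, ht, hpt⟩
    refine hpt.trans (ht.2.2 _ hs.1.one_sub fun i => ?_)
    obtain ⟨hqi, hqA, hq0, y, -, -, hy⟩ := hq i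
    exact hs.le_one_sub hφ hqi (hst.eq_zero_of_sotSum hT hφ hqA hq0 hy).1
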